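/- arXiv:2501.07282 — 3 statements merged into one kernel-verified Lean document; each statement's English description precedes it below -/
import Mathlib

section
/- Let G be a countable discrete amenable group, (V,‖·‖) a semi-normed real vector space, and π: G → Isom(V) a uniformly bounded representation. If u belongs to the ‖·‖-closure of the subspace L = span{v − π(g)v : v ∈ V, g ∈ G}, then limsup_{F→G} ‖A_F u‖ = 0. -/
open scoped Pointwise
open Filter

/-- The collection `F(G)` of non-empty finite subsets of `G`. -/
def FinG (G : Type*) := {F : Finset G // F.Nonempty}

section Defs

variable {G : Type*} [Group G] [DecidableEq G]

/-- `F` is `(K, δ)`-invariant: `|KF Δ F| ≤ δ|F|`. -/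
def IsInv (K : Finset G) (δ : ℝ) (F : Finset G) : Prop :=
  ((symmDiff (K * F) F).card : ℝ) ≤ δ * (F.card : ℝ)

/-- `G` is amenable: for every `(K, δ)` there is a `(K, δ)`-invariant nonempty finite set. -/
def AmenableG (G : Type*) [Group G] [DecidableEq G] : Prop :=
  ∀ K : Finset G, K.Nonempty → ∀ δ : ℝ, 0 < δ →
    ∃ F : Finset G, F.Nonempty ∧ IsInv K δ F

/-- `limsup_{F → G} φ(F) = inf_{(K,δ)} sup {φ(F) : F is (K,δ)-invariant}` (in the extended reals). -/
noncomputable def limsupG (φ : FinG G → ℝ) : EReal :=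
  ⨅ (K : {K : Finset G // K.Nonempty}) (δ : {d : ℝ // 0 < d}),
    ⨆ F : {F : FinG G // IsInv K.1 δ.1 F.1}, (φ F.1 : EReal)

/-- `liminf_{F → G} φ(F) = sup_{(K,δ)} inf {φ(F) : F is (K,δ)-invariant}` (in the extended reals). -/
noncomputable def liminfG (φ : FinG G → ℝ) : EReal :=
  ⨆ (K : {K : Finset G // K.Nonempty}) (δ : {d : ℝ // 0 < d}),
    ⨅ F : {F : FinG G // IsInv K.1 δ.1 F.1}, (φ F.1 : EReal)

/-- `lim_{F → G} φ(F) = L`. -/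
def TendstoG (φ : FinG G → ℝ) (L : ℝ) : Prop :=
  ∀ ε : ℝ, 0 < ε → ∃ (K : Finset G) (δ : ℝ), K.Nonempty ∧ 0 < δ ∧
    ∀ F : FinG G, IsInv K δ F.1 → |φ F - L| < ε

/-- A (left) Følner sequence: `|F_n Δ g F_n| / |F_n| → 0` for every `g ∈ G`. -/
def FolnerSeq (F : ℕ → FinG G) : Prop :=
  ∀ g : G, Filter.Tendsto
    (fun n => ((symmDiff ((F n).1.image (fun h => g * h)) (F n).1).card : ℝ) / ((F n).1.card : ℝ))
    Filter.atTop (nhds (0 : ℝ))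

variable {V : Type*} [SeminormedAddCommGroup V] [NormedSpace ℝ V]

/-- The representation `π` is uniformly bounded with constant `C`. -/
def UnifBdd (π : G →* (V ≃L[ℝ] V)) (C : ℝ) : Prop :=
  ∀ (g : G) (v : V), ‖π g v‖ ≤ C * ‖v‖

/-- The representation `π` is isometric (`C_π = 1`). -/
def IsIsometric (π : G →* (V ≃L[ℝ] V)) : Prop :=
  ∀ (g : G) (v : V), ‖π g v‖ = ‖v‖

/-- The ergodic sum `S_F v = Σ_{g ∈ F} π(g⁻¹) v`. -/
noncomputable def SF (π : G →* (V ≃L[ℝ] V)) (F : Finset G) (v : V) : V :=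
  ∑ g ∈ F, π g⁻¹ v

/-- The ergodic average `A_F v = |F|⁻¹ • S_F v`. -/
noncomputable def AF (π : G →* (V ≃L[ℝ] V)) (F : Finset G) (v : V) : V :=
  (F.card : ℝ)⁻¹ • SF π F v

/-- Right translation `g • F = F g⁻¹` on nonempty finite subsets. -/
def rT (g : G) (F : FinG G) : FinG G :=
  ⟨F.1.image (fun h => h * g⁻¹), F.2.image (fun h => h * g⁻¹)⟩

/-- `G`-equivariance of a set map: `π(g) φ(F) = φ(F g⁻¹)`. -/
def IsEquivariant (π : G →* (V ≃L[ℝ] V)) (φ : FinG G → V) : Prop :=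
  ∀ (g : G) (F : FinG G), π g (φ F) = φ (rT g F)

/-- Boundedness of a set map: `sup_F ‖φ(F)‖/|F| < ∞`. -/
def IsBddMap (φ : FinG G → V) : Prop :=
  ∃ C : ℝ, ∀ F : FinG G, ‖φ F‖ ≤ C * (F.1.card : ℝ)

/-- Membership in the space `M` of bounded `G`-equivariant set maps. -/
def MemM (π : G →* (V ≃L[ℝ] V)) (φ : FinG G → V) : Prop :=
  IsBddMap φ ∧ IsEquivariant π φ

/-- The sup seminorm `|||φ|||_sup = sup_F ‖φ(F)‖/|F|`. -/
noncomputable def supNorm (φ : FinG G → V) : ℝ :=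
  ⨆ F : FinG G, ‖φ F‖ / (F.1.card : ℝ)

/-- The asymptotic seminorm `|||φ|||_G = limsup_{F → G} ‖φ(F)‖/|F|` (in the extended reals). -/
noncomputable def normG (φ : FinG G → V) : EReal :=
  limsupG (fun F => ‖φ F‖ / (F.1.card : ℝ))

/-- Union of nonempty finite subsets. -/
def unionF (E F : FinG G) : FinG G :=
  ⟨E.1 ∪ F.1, E.2.inl⟩

/-- Additive set maps: `φ(E ⊔ F) = φ(E) + φ(F)` for disjoint `E, F`. -/
def IsAdditiveMap (φ : FinG G → V) : Prop :=
  ∀ E F : FinG G, Disjoint E.1 F.1 → φ (unionF E F) = φ E + φ F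

/-- The additive set map `S(v)(F) = S_F v`. -/
noncomputable def Smap (π : G →* (V ≃L[ℝ] V)) (v : V) : FinG G → V :=
  fun F => SF π F.1 v

/-- The coboundary subspace `L_W = span{w − π(g)w : w ∈ W, g ∈ G}`. -/
def cobSpan (π : G →* (V ≃L[ℝ] V)) (W : Set V) : Submodule ℝ V :=
  Submodule.span ℝ {x | ∃ w ∈ W, ∃ g : G, x = w - π g w}

/-- The coboundary subspace `L = L_V`. -/
def cobL (π : G →* (V ≃L[ℝ] V)) : Submodule ℝ V :=
  cobSpan π Set.univ

/-- The quotient seminorm `‖v + U‖_U = inf_{u ∈ U} ‖v + u‖`. -/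
noncomputable def qnorm (U : Set V) (v : V) : ℝ :=
  ⨅ u : U, ‖v + u.1‖

/-- `v` is an additive realization of `φ`: `lim_{F→G} ‖φ(F)/|F| − A_F v‖ = 0`. -/
def IsRealization (π : G →* (V ≃L[ℝ] V)) (φ : FinG G → V) (v : V) : Prop :=
  TendstoG (fun F => ‖(F.1.card : ℝ)⁻¹ • φ F - AF π F.1 v‖) 0

/-- `φ` is asymptotically additive: `inf_{ψ ∈ M_⊕} |||φ − ψ|||_G = 0`. -/
def AsympAdd (π : G →* (V ≃L[ℝ] V)) (φ : FinG G → V) : Prop :=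
  (⨅ ψ : {ψ : FinG G → V // MemM π ψ ∧ IsAdditiveMap ψ}, normG (φ - ψ.1)) = (0 : EReal)

/-- `φ` is asymptotically additive relative to `W`. -/
def AsympAddRel (π : G →* (V ≃L[ℝ] V)) (W : Set V) (φ : FinG G → V) : Prop :=
  (⨅ w : W, limsupG (fun F => ‖(F.1.card : ℝ)⁻¹ • φ F - AF π F.1 w.1‖)) = (0 : EReal)

/-- The quotient norm on `M_⊕ / N_⊕`. -/
noncomputable def qMplusN (π : G →* (V ≃L[ℝ] V)) (ψ : FinG G → V) : ℝ :=
  ⨅ η : {η : FinG G → V // MemM π η ∧ IsAdditiveMap η ∧ normG η = (0 : EReal)},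
    supNorm (ψ + η.1)

end Defs

/-- A pointwise bound on `f` bounds the difference of its sums over two sets of equal size. -/
lemma norm_sum_sub_sum_le_of_card_eq {ι V : Type*} [DecidableEq ι]
    [SeminormedAddCommGroup V] {s t : Finset ι}
    (hst : s.card = t.card) {f : ι → V} {c : ℝ} (hf : ∀ i, ‖f i‖ ≤ c) :
    ‖∑ i ∈ s, f i - ∑ i ∈ t, f i‖ ≤ 2 * c * ((t \ s).card : ℝ) := by
  have hb (r : Finset ι) : ‖∑ i ∈ r, f i‖ ≤ (r.card : ℝ) * c := by
    simpa using norm_sum_le_of_le r (fun i _ => hf i)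
  rw [← Finset.sum_sdiff_sub_sum_sdiff]
  calc _ ≤ ((s \ t).card : ℝ) * c + ((t \ s).card : ℝ) * c :=
        (norm_sub_le _ _).trans (add_le_add (hb _) (hb _))
    _ = _ := by rw [Finset.card_sdiff_comm hst]; ring

section Helpers

variable {G : Type*} [Group G] {V : Type*} [SeminormedAddCommGroup V] [NormedSpace ℝ V]

lemma SF_add (π : G →* (V ≃L[ℝ] V)) (F : Finset G) (v w : V) :
    SF π F (v + w) = SF π F v + SF π F w := by
  simp [SF, Finset.sum_add_distrib]

lemma SF_sub (π : G →* (V ≃L[ℝ] V)) (F : Finset G) (v w : V) :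
    SF π F (v - w) = SF π F v - SF π F w := by
  simp [SF, Finset.sum_sub_distrib]

lemma SF_smul (π : G →* (V ≃L[ℝ] V)) (F : Finset G) (a : ℝ) (v : V) :
    SF π F (a • v) = a • SF π F v := by
  simp [SF, Finset.smul_sum]

lemma UnifBdd.norm_apply_le {π : G →* (V ≃L[ℝ] V)} {C : ℝ} (hπ : UnifBdd π C) (g : G) (v : V) :
    ‖π g v‖ ≤ |C| * ‖v‖ :=
  (hπ g v).trans (by gcongr; exact le_abs_self C)

lemma UnifBdd.norm_SF_le {π : G →* (V ≃L[ℝ] V)} {C : ℝ} (hπ : UnifBdd π C)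
    (F : Finset G) (v : V) : ‖SF π F v‖ ≤ (F.card : ℝ) * (|C| * ‖v‖) := by
  simpa [SF] using norm_sum_le_of_le F (fun g _ => hπ.norm_apply_le g⁻¹ v)

variable [DecidableEq G]

lemma SF_apply (π : G →* (V ≃L[ℝ] V)) (F : Finset G) (g : G) (v : V) :
    SF π F (π g v) = SF π ({g⁻¹} * F) v := by
  rw [SF, SF, Finset.singleton_mul, Finset.smul_finset_def, Finset.sum_image (by simp)]
  simp only [smul_eq_mul, mul_inv_rev, inv_inv, map_mul]
  rfl

/-- Ergodic sums of a coboundary are controlled by the size of an outer boundary. -/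
lemma UnifBdd.exists_norm_SF_le_card_sdiff {π : G →* (V ≃L[ℝ] V)} {C : ℝ} (hπ : UnifBdd π C)
    {v : V} (hv : v ∈ cobL π) :
    ∃ (K : Finset G) (M : ℝ), K.Nonempty ∧ 0 ≤ M ∧
      ∀ F : Finset G, ‖SF π F v‖ ≤ M * (((K * F) \ F).card : ℝ) := by
  rw [cobL, cobSpan] at hv
  induction hv using Submodule.span_induction with
  | mem x hx =>
    obtain ⟨w, -, g, rfl⟩ := hx
    refine ⟨{g⁻¹}, 2 * (|C| * ‖w‖), by simp, by positivity, fun F => ?_⟩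
    rw [SF_sub, SF_apply]
    exact norm_sum_sub_sum_le_of_card_eq (by simp) (fun h => hπ.norm_apply_le h⁻¹ w)
  | zero => exact ⟨{1}, 0, by simp, le_rfl, by simp [SF]⟩
  | add x y _ _ hx hy =>
    obtain ⟨K, M, hK, hM, hx⟩ := hx
    obtain ⟨K', M', -, hM', hy⟩ := hy
    refine ⟨K ∪ K', M + M', hK.inl, by positivity, fun F => ?_⟩
    rw [SF_add, add_mul]
    refine (norm_add_le _ _).trans (add_le_add ((hx F).trans ?_) ((hy F).trans ?_))
    · gcongr
      exact Finset.subset_union_left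
    · gcongr
      exact Finset.subset_union_right
  | smul a x _ hx =>
    obtain ⟨K, M, hK, hM, hx⟩ := hx
    refine ⟨K, |a| * M, hK, by positivity, fun F => ?_⟩
    rw [SF_smul, norm_smul, Real.norm_eq_abs, mul_assoc]
    gcongr
    exact hx F

lemma limsupG_nonneg (hG : AmenableG G) {φ : FinG G → ℝ} (hφ : ∀ F, 0 ≤ φ F) :
    0 ≤ limsupG φ := by
  refine le_iInf fun K => le_iInf fun δ => ?_
  obtain ⟨F, hF, hinv⟩ := hG K.1 K.2 δ.1 δ.2
  exact le_iSup_of_le ⟨⟨F, hF⟩, hinv⟩ (by exact_mod_cast hφ _)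

lemma limsupG_le {φ : FinG G → ℝ} {K : Finset G} (hK : K.Nonempty) {δ : ℝ} (hδ : 0 < δ) {a : ℝ}
    (h : ∀ F : FinG G, IsInv K δ F.1 → φ F ≤ a) : limsupG φ ≤ a :=
  iInf_le_of_le ⟨K, hK⟩ <| iInf_le_of_le ⟨δ, hδ⟩ <| iSup_le fun F =>
    EReal.coe_le_coe_iff.2 (h F.1 F.2)

lemma IsInv.card_sdiff_le {K F : Finset G} {δ : ℝ} (h : IsInv K δ F) :
    (((K * F) \ F).card : ℝ) ≤ δ * F.card :=
  le_trans (by gcongr; exact le_sup_left (a := (K * F) \ F) (b := F \ (K * F))) h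

end Helpers

theorem statement2 {G : Type*} [Group G] [DecidableEq G] [Countable G]
    {V : Type*} [SeminormedAddCommGroup V] [NormedSpace ℝ V]
    (hG : AmenableG G) (π : G →* (V ≃L[ℝ] V)) (C : ℝ) (hπ : UnifBdd π C)
    (u : V) (hu : u ∈ closure (cobL π : Set V)) :
    limsupG (fun F => ‖AF π F.1 u‖) = (0 : EReal) := by
  refine le_antisymm ?_ (limsupG_nonneg hG fun F => norm_nonneg _)
  refine EReal.le_of_forall_lt_iff_le.1 fun ε hε => ?_
  replace hε : 0 < ε := by exact_mod_cast hε
  obtain ⟨w, hw, huw⟩ := Metric.mem_closure_iff.1 hu (ε / 2 / (|C| + 1)) (by positivity)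
  rw [dist_eq_norm, lt_div_iff₀ (by positivity)] at huw
  obtain ⟨K, M, hK, hM, hKM⟩ := hπ.exists_norm_SF_le_card_sdiff hw
  refine limsupG_le hK (δ := ε / 2 / (M + 1)) (by positivity) fun F hF => ?_
  have hcard : 0 < (F.1.card : ℝ) := by exact_mod_cast F.2.card_pos
  have hδ : M * (ε / 2 / (M + 1)) ≤ ε / 2 := by
    rw [mul_div_assoc', div_le_iff₀ (by positivity)]
    nlinarith
  rw [AF, norm_smul, norm_inv, Real.norm_of_nonneg hcard.le, inv_mul_le_iff₀ hcard]
  calc ‖SF π F.1 u‖ = ‖SF π F.1 (u - w) + SF π F.1 w‖ := by rw [← SF_add, sub_add_cancel]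
    _ ≤ F.1.card * (|C| * ‖u - w‖) + M * (ε / 2 / (M + 1) * F.1.card) :=
      (norm_add_le _ _).trans <| add_le_add (hπ.norm_SF_le _ _) <|
        (hKM _).trans (mul_le_mul_of_nonneg_left hF.card_sdiff_le hM)
    _ = F.1.card * (|C| * ‖u - w‖ + M * (ε / 2 / (M + 1))) := by ring
    _ ≤ F.1.card * ε := by
      gcongr
      nlinarith [norm_nonneg (u - w)]
end

section
/- Let G be a countable discrete amenable group, (V,‖·‖) a semi-normed real vector space, π: G → Isom(V) a uniformly bounded representation, W ⊆ V a subset, and U a subspace of V with L_W ⊆ U, where L_W = span{w − π(g)w : w ∈ W, g ∈ G}. Then for every w in the ‖·‖-closure of the linear span of W, ‖w + U‖_U ≤ inf_{F∈F(G)} ‖A_F w‖. In particular, taking W = V and U = L = L_V, ‖v + L‖_L ≤ inf_{F∈F(G)} ‖A_F v‖ for every v ∈ V. -/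
open scoped Pointwise
open Filter

section QuotientSeminorm

variable {G : Type*} [Group G]
variable {V : Type*} [SeminormedAddCommGroup V]

lemma qnorm_le_norm_add_of_mem_closure {U : Set V} (v : V) {x : V} (hx : x ∈ closure U) :
    qnorm U v ≤ ‖v + x‖ := by
  have hclosed : IsClosed {y : V | qnorm U v ≤ ‖v + y‖} :=
    isClosed_le continuous_const (by fun_prop)
  have hbdd : BddBelow (Set.range fun u : U => ‖v + u.1‖) :=
    ⟨0, Set.forall_mem_range.2 fun u => norm_nonneg (v + u.1)⟩
  exact closure_minimal (fun u hu => ciInf_le hbdd (⟨u, hu⟩ : U)) hclosed hx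

variable [NormedSpace ℝ V]

lemma sub_map_mem_cobSpan (π : G →* (V ≃L[ℝ] V)) {W : Set V} {w : V}
    (hw : w ∈ Submodule.span ℝ W) (g : G) : w - π g w ∈ cobSpan π W := by
  induction hw using Submodule.span_induction with
  | mem x hx => exact Submodule.subset_span ⟨x, hx, g, rfl⟩
  | zero => simp
  | add x y _ _ hx hy =>
    rw [map_add, add_sub_add_comm]
    exact add_mem hx hy
  | smul a x _ hx =>
    rw [map_smul, ← smul_sub]
    exact Submodule.smul_mem _ a hx

lemma AF_sub_self_eq (π : G →* (V ≃L[ℝ] V)) {F : Finset G} (hF : F.Nonempty) (v : V) :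
    AF π F v - v = -((F.card : ℝ)⁻¹ • ∑ g ∈ F, (v - π g⁻¹ v)) := by
  have hcard : (F.card : ℝ) ≠ 0 := by exact_mod_cast hF.card_ne_zero
  rw [Finset.sum_sub_distrib, Finset.sum_const, smul_sub, ← Nat.cast_smul_eq_nsmul ℝ,
    inv_smul_smul₀ hcard, neg_sub]
  rfl

lemma AF_sub_self_mem_cobSpan (π : G →* (V ≃L[ℝ] V)) {W : Set V} {F : Finset G}
    (hF : F.Nonempty) {w : V} (hw : w ∈ Submodule.span ℝ W) : AF π F w - w ∈ cobSpan π W := by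
  rw [AF_sub_self_eq π hF]
  exact neg_mem (Submodule.smul_mem _ _ (sum_mem fun g _ => sub_map_mem_cobSpan π hw g⁻¹))

lemma continuous_AF (π : G →* (V ≃L[ℝ] V)) (F : Finset G) : Continuous (AF π F) := by
  unfold AF SF
  fun_prop

lemma qnorm_le_iInf_norm_AF (π : G →* (V ≃L[ℝ] V)) {W U : Set V}
    (hWU : (cobSpan π W : Set V) ⊆ U) {w : V}
    (hw : w ∈ closure (Submodule.span ℝ W : Set V)) :
    qnorm U w ≤ ⨅ F : FinG G, ‖AF π F.1 w‖ := by
  have : Nonempty (FinG G) := ⟨⟨{1}, Finset.singleton_nonempty 1⟩⟩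
  refine le_ciInf fun F => ?_
  have hmem : AF π F.1 w - w ∈ closure U :=
    map_mem_closure (f := fun x => AF π F.1 x - x) ((continuous_AF π F.1).sub continuous_id) hw
      fun _ hx => hWU (AF_sub_self_mem_cobSpan π F.2 hx)
  simpa using qnorm_le_norm_add_of_mem_closure w hmem

end QuotientSeminorm

theorem statement4 {G : Type*} [Group G] [DecidableEq G] [Countable G]
    {V : Type*} [SeminormedAddCommGroup V] [NormedSpace ℝ V]
    (hG : AmenableG G) (π : G →* (V ≃L[ℝ] V)) (C : ℝ) (hπ : UnifBdd π C)
    (W : Set V) (U : Submodule ℝ V)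
    (hWU : (cobSpan π W : Set V) ⊆ (U : Set V)) :
    (∀ w ∈ closure ((Submodule.span ℝ W : Submodule ℝ V) : Set V),
      qnorm (U : Set V) w ≤ ⨅ F : FinG G, ‖AF π F.1 w‖) ∧
    (∀ v : V, qnorm (cobL π : Set V) v ≤ ⨅ F : FinG G, ‖AF π F.1 v‖) := by
  refine ⟨fun w hw => qnorm_le_iInf_norm_AF π hWU hw, fun v => ?_⟩
  exact qnorm_le_iInf_norm_AF π (W := Set.univ) subset_rfl
    (subset_closure (Submodule.subset_span (Set.mem_univ v)))
end

section
/- Let G be a countable discrete amenable group, (V,‖·‖) a complete semi-normed real vector space, π: G → Isom(V) a uniformly bounded representation, and φ ∈ M a bounded G-equivariant set map. If inf_{v∈V} limsup_{F→G} ‖φ(F)/|F| − A_F v‖ = 0, then there exists v ∈ V such that lim_{F→G} ‖φ(F)/|F| − A_F v‖ = 0. -/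
open scoped Pointwise
open Filter

section Invariance

variable {G : Type*} [Group G] [DecidableEq G]

theorem IsInv.of_subset {K K' F : Finset G} {δ δ' : ℝ} (h : IsInv K' δ' F)
    (hK : K.Nonempty) (hsub : K ⊆ K') (hδ : 2 * δ' ≤ δ) : IsInv K δ F := by
  unfold IsInv at *
  have hcard : F.card ≤ (K * F).card := Finset.card_le_card_mul_left hK
  have hdiff : (F \ (K * F)).card ≤ ((K * F) \ F).card :=
    Finset.card_sdiff_le_card_sdiff_iff.2 hcard
  have hmono : ((K * F) \ F).card ≤ (symmDiff (K' * F) F).card :=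
    Finset.card_le_card fun x hx => by
      rw [Finset.mem_sdiff] at hx
      exact Finset.mem_symmDiff.2 (Or.inl ⟨Finset.mul_subset_mul_right hsub hx.1, hx.2⟩)
  have hunion : (symmDiff (K * F) F).card ≤ ((K * F) \ F).card + (F \ (K * F)).card :=
    Finset.card_union_le _ _
  have htwo : ((symmDiff (K * F) F).card : ℝ) ≤ 2 * ((symmDiff (K' * F) F).card : ℝ) := by
    exact_mod_cast (show _ ≤ 2 * _ by omega)
  nlinarith [(Nat.cast_nonneg F.card : (0 : ℝ) ≤ F.card)]

variable (G) in
/-- The filter on `F(G)` generated by the sets of `(K, δ)`-invariant finite sets. -/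
def invFilter : Filter (FinG G) where
  sets := {s | ∃ (K : Finset G) (δ : ℝ), K.Nonempty ∧ 0 < δ ∧ ∀ F : FinG G, IsInv K δ F.1 → F ∈ s}
  univ_sets := ⟨{1}, 1, Finset.singleton_nonempty 1, one_pos, fun _ _ => trivial⟩
  sets_of_superset := by
    rintro s t ⟨K, δ, hK, hδ, h⟩ hst
    exact ⟨K, δ, hK, hδ, fun F hF => hst (h F hF)⟩
  inter_sets := by
    rintro s t ⟨K, δ, hK, hδ, h⟩ ⟨K', δ', hK', hδ', h'⟩
    refine ⟨K ∪ K', min δ δ' / 2, hK.inl, by positivity, fun F hF => ⟨h F ?_, h' F ?_⟩⟩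
    · exact hF.of_subset hK Finset.subset_union_left (by linarith [min_le_left δ δ'])
    · exact hF.of_subset hK' Finset.subset_union_right (by linarith [min_le_right δ δ'])

theorem eventually_invFilter {p : FinG G → Prop} :
    (∀ᶠ F in invFilter G, p F) ↔
      ∃ (K : Finset G) (δ : ℝ), K.Nonempty ∧ 0 < δ ∧ ∀ F : FinG G, IsInv K δ F.1 → p F :=
  Iff.rfl

theorem AmenableG.invFilter_neBot (hG : AmenableG G) : (invFilter G).NeBot := by
  refine ⟨fun h => ?_⟩
  obtain ⟨K, δ, hK, hδ, hF⟩ := Filter.empty_mem_iff_bot.2 h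
  obtain ⟨F, hne, hinv⟩ := hG K hK δ hδ
  exact hF ⟨F, hne⟩ hinv

theorem tendstoG_iff_tendsto {ψ : FinG G → ℝ} {L : ℝ} :
    TendstoG ψ L ↔ Tendsto ψ (invFilter G) (nhds L) := by
  simp_rw [Metric.tendsto_nhds, eventually_invFilter, Real.dist_eq, TendstoG]

theorem eventually_lt_of_limsupG_lt {ψ : FinG G → ℝ} {ε : ℝ} (h : limsupG ψ < (ε : EReal)) :
    ∀ᶠ F in invFilter G, ψ F < ε := by
  obtain ⟨K, hK⟩ := iInf_lt_iff.1 h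
  obtain ⟨δ, hδ⟩ := iInf_lt_iff.1 hK
  refine eventually_invFilter.2 ⟨K.1, δ.1, K.2, δ.2, fun F hF => EReal.coe_lt_coe_iff.1 ?_⟩
  exact (le_iSup (fun F : {F : FinG G // IsInv K.1 δ.1 F.1} => (ψ F.1 : EReal)) ⟨F, hF⟩).trans_lt hδ

end Invariance

section Averages

variable {G : Type*} [Group G]
variable {V : Type*} [SeminormedAddCommGroup V] [NormedSpace ℝ V]

theorem AF_add (π : G →* (V ≃L[ℝ] V)) (F : Finset G) (v w : V) :
    AF π F (v + w) = AF π F v + AF π F w := by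
  simp [AF, SF, Finset.sum_add_distrib]

theorem AF_sub (π : G →* (V ≃L[ℝ] V)) (F : Finset G) (v w : V) :
    AF π F (v - w) = AF π F v - AF π F w := by
  simp [AF, SF, Finset.sum_sub_distrib, smul_sub]

theorem AF_smul (π : G →* (V ≃L[ℝ] V)) (F : Finset G) (c : ℝ) (v : V) :
    AF π F (c • v) = c • AF π F v := by
  simp [AF, SF, ← Finset.smul_sum, smul_comm c]

theorem UnifBdd.norm_AF_le {π : G →* (V ≃L[ℝ] V)} {C : ℝ} (hπ : UnifBdd π C) (F : FinG G) (v : V) :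
    ‖AF π F.1 v‖ ≤ C * ‖v‖ := by
  have hpos : (0 : ℝ) < F.1.card := by exact_mod_cast F.2.card_pos
  have hsum : ‖SF π F.1 v‖ ≤ F.1.card * (C * ‖v‖) := by
    simpa [SF] using norm_sum_le_of_le F.1 (f := fun g => π g⁻¹ v) fun g _ => hπ g⁻¹ v
  rw [AF, norm_smul, norm_inv, Real.norm_natCast, inv_mul_le_iff₀ hpos]
  exact hsum

variable [DecidableEq G]

/-- The vectors whose ergodic averages tend to zero. -/
def vanishingAverages (π : G →* (V ≃L[ℝ] V)) : Submodule ℝ V where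
  carrier := {w | Tendsto (fun F : FinG G => AF π F.1 w) (invFilter G) (nhds 0)}
  zero_mem' := by simp [AF, SF, tendsto_const_nhds]
  add_mem' := fun {v w} hv hw => by
    simpa only [Set.mem_ofPred_eq, AF_add, add_zero] using Tendsto.add hv hw
  smul_mem' := fun c v hv => by
    simpa only [Set.mem_ofPred_eq, AF_smul, smul_zero] using Tendsto.const_smul hv c

theorem SF_map_apply (π : G →* (V ≃L[ℝ] V)) (F : Finset G) (g : G) (w : V) :
    SF π F (π g w) = SF π ({g⁻¹} * F) w := by
  rw [SF, SF, Finset.singleton_mul, ← Finset.image_smul,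
    Finset.sum_image fun x _ y _ h => smul_left_cancel g⁻¹ h]
  refine Finset.sum_congr rfl fun x _ => ?_
  rw [smul_eq_mul, mul_inv_rev, inv_inv, map_mul]
  rfl

theorem UnifBdd.norm_SF_sub_SF_le {π : G →* (V ≃L[ℝ] V)} {C : ℝ} (hπ : UnifBdd π C)
    (E F : Finset G) (w : V) :
    ‖SF π E w - SF π F w‖ ≤ (symmDiff E F).card * (C * ‖w‖) := by
  have hcard : (symmDiff E F).card = (E \ F).card + (F \ E).card :=
    Finset.card_union_of_disjoint disjoint_sdiff_sdiff
  have hle : ∀ S : Finset G, ‖∑ g ∈ S, π g⁻¹ w‖ ≤ S.card * (C * ‖w‖) := fun S => by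
    simpa using norm_sum_le_of_le S (f := fun g => π g⁻¹ w) fun g _ => hπ g⁻¹ w
  rw [SF, SF, ← Finset.sum_sdiff_sub_sum_sdiff, hcard, Nat.cast_add, add_mul]
  exact (norm_sub_le _ _).trans (add_le_add (hle _) (hle _))

theorem UnifBdd.map_sub_self_mem_vanishingAverages {π : G →* (V ≃L[ℝ] V)} {C : ℝ}
    (hπ : UnifBdd π C) (g : G) (w : V) : π g w - w ∈ vanishingAverages π := by
  have hC : 0 ≤ C * ‖w‖ := (norm_nonneg _).trans (hπ 1 w)
  refine Metric.tendsto_nhds.2 fun ε hε => eventually_invFilter.2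
    ⟨{g⁻¹}, ε / (C * ‖w‖ + 1), Finset.singleton_nonempty _, by positivity, fun F hF => ?_⟩
  have hpos : (0 : ℝ) < F.1.card := by exact_mod_cast F.2.card_pos
  rw [dist_zero_right, AF_sub, AF, AF, SF_map_apply, ← smul_sub, norm_smul, norm_inv,
    Real.norm_natCast, inv_mul_lt_iff₀ hpos]
  calc ‖SF π ({g⁻¹} * F.1) w - SF π F.1 w‖
      ≤ (symmDiff ({g⁻¹} * F.1) F.1).card * (C * ‖w‖) := hπ.norm_SF_sub_SF_le _ _ w
    _ ≤ ε / (C * ‖w‖ + 1) * F.1.card * (C * ‖w‖) := mul_le_mul_of_nonneg_right hF hC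
    _ = F.1.card * ε * ((C * ‖w‖) / (C * ‖w‖ + 1)) := by ring
    _ < F.1.card * ε := mul_lt_of_lt_one_right (by positivity)
        ((div_lt_one (by positivity)).2 (lt_add_one _))

theorem UnifBdd.AF_sub_self_mem_vanishingAverages {π : G →* (V ≃L[ℝ] V)} {C : ℝ}
    (hπ : UnifBdd π C) (F : FinG G) (v : V) : AF π F.1 v - v ∈ vanishingAverages π := by
  have hne : (F.1.card : ℝ) ≠ 0 := by exact_mod_cast F.2.card_pos.ne'
  have heq : AF π F.1 v - v = (F.1.card : ℝ)⁻¹ • ∑ g ∈ F.1, (π g⁻¹ v - v) := by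
    rw [Finset.sum_sub_distrib, Finset.sum_const, ← Nat.cast_smul_eq_nsmul ℝ, smul_sub, smul_smul,
      inv_mul_cancel₀ hne, one_smul, AF, SF]
  rw [heq]
  exact Submodule.smul_mem _ _ <| Submodule.sum_mem _ fun g _ =>
    hπ.map_sub_self_mem_vanishingAverages g⁻¹ v

end Averages

theorem statement9 {G : Type*} [Group G] [DecidableEq G] [Countable G]
    {V : Type*} [SeminormedAddCommGroup V] [NormedSpace ℝ V] [CompleteSpace V]
    (hG : AmenableG G) (π : G →* (V ≃L[ℝ] V)) (C : ℝ) (hπ : UnifBdd π C)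
    (φ : FinG G → V) (hφ : MemM π φ)
    (haa : (⨅ v : V,
      limsupG (fun F => ‖(F.1.card : ℝ)⁻¹ • φ F - AF π F.1 v‖)) = (0 : EReal)) :
    ∃ v : V, TendstoG (fun F => ‖(F.1.card : ℝ)⁻¹ • φ F - AF π F.1 v‖) 0 := by
  have := hG.invFilter_neBot
  set ψ : FinG G → V := fun F => (F.1.card : ℝ)⁻¹ • φ F
  have approx : ∀ n : ℕ, ∃ v : V, ∀ᶠ F in invFilter G, ‖ψ F - AF π F.1 v‖ < (1 / 2) ^ n := by
    intro n
    have hn : (0 : EReal) < (((1 / 2) ^ n : ℝ) : EReal) := by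
      exact_mod_cast (by positivity : (0 : ℝ) < (1 / 2) ^ n)
    rw [← haa] at hn
    obtain ⟨v, hv⟩ := iInf_lt_iff.1 hn
    exact ⟨v, eventually_lt_of_limsupG_lt hv⟩
  choose v hv using approx
  have avg : ∀ n : ℕ, ∃ F : FinG G, ‖AF π F.1 (v (n + 1) - v n)‖ ≤ 2 * (1 / 2) ^ n := by
    intro n
    obtain ⟨F, hF, hF'⟩ := ((hv n).and (hv (n + 1))).exists
    refine ⟨F, ?_⟩
    have hsplit : AF π F.1 (v (n + 1) - v n) =
        (ψ F - AF π F.1 (v n)) - (ψ F - AF π F.1 (v (n + 1))) := by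
      rw [AF_sub]
      abel
    have hpow : (1 / 2 : ℝ) ^ (n + 1) ≤ (1 / 2) ^ n :=
      pow_le_pow_of_le_one (by norm_num) (by norm_num) n.le_succ
    rw [hsplit]
    linarith [norm_sub_le (ψ F - AF π F.1 (v n)) (ψ F - AF π F.1 (v (n + 1)))]
  choose E hE using avg
  let u : ℕ → V := fun n => v 0 + ∑ i ∈ Finset.range n, AF π (E i).1 (v (i + 1) - v i)
  have hu_succ : ∀ n, u (n + 1) = u n + AF π (E n).1 (v (n + 1) - v n) := fun n => by
    simp only [u, Finset.sum_range_succ, add_assoc]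
  have hu_cauchy : CauchySeq u := cauchySeq_of_le_geometric (1 / 2) 2 (by norm_num) fun n => by
    rw [hu_succ, dist_self_add_right]
    exact hE n
  have hu_mem : ∀ n, u n - v n ∈ vanishingAverages π := by
    intro n
    induction n with
    | zero => simp [u]
    | succ n ih =>
      have hstep : u (n + 1) - v (n + 1) = (u n - v n) +
          (AF π (E n).1 (v (n + 1) - v n) - (v (n + 1) - v n)) := by
        rw [hu_succ]
        abel
      rw [hstep]
      exact add_mem ih (hπ.AF_sub_self_mem_vanishingAverages _ _)
  obtain ⟨w, hw⟩ := cauchySeq_tendsto_of_complete hu_cauchy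
  refine ⟨w, tendstoG_iff_tendsto.2 (tendsto_zero_iff_norm_tendsto_zero.1 ?_)⟩
  refine Metric.tendsto_nhds.2 fun ε hε => ?_
  have hdist : Tendsto (fun n => C * ‖u n - w‖) atTop (nhds 0) := by
    simpa using (tendsto_iff_norm_sub_tendsto_zero.1 hw).const_mul C
  have hpow : Tendsto (fun n : ℕ => (1 / 2 : ℝ) ^ n) atTop (nhds 0) :=
    tendsto_pow_atTop_nhds_zero_of_lt_one (by norm_num) (by norm_num)
  obtain ⟨n, hn, hn'⟩ := ((hdist.eventually_lt_const (by positivity : 0 < ε / 3)).and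
    (hpow.eventually_lt_const (by positivity : 0 < ε / 3))).exists
  filter_upwards [hv n, Metric.tendsto_nhds.1 (hu_mem n) (ε / 3) (by positivity)] with F hF hF'
  rw [dist_zero_right] at hF' ⊢
  have hsplit : ψ F - AF π F.1 w =
      (ψ F - AF π F.1 (v n)) - AF π F.1 (u n - v n) + AF π F.1 (u n - w) := by
    rw [AF_sub, AF_sub]
    abel
  rw [hsplit]
  linarith [norm_add_le (ψ F - AF π F.1 (v n) - AF π F.1 (u n - v n)) (AF π F.1 (u n - w)),
    norm_sub_le (ψ F - AF π F.1 (v n)) (AF π F.1 (u n - v n)), hπ.norm_AF_le F (u n - w)]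
end
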